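/- arXiv:2406.06074 — 2 statements merged into one kernel-verified Lean document; each statement's English description precedes it below -/
import Mathlib

section
/- Let X be a complex Banach space and T ∈ B(X) a Ritt operator, i.e. σ(T) ⊆ closed unit disc and there exists C > 0 with ‖(z - T)⁻¹‖ ≤ C/|z - 1| for all z with |z| > 1. Then T is power bounded: sup_{k ≥ 0} ‖T^k‖ < ∞. -/
open Real in
/-- The mean of `1 / |1 - w|²` over the circle `|w| = s < 1`, i.e. the mean of the Poisson kernel. -/
lemma circleAverage_inv_norm_one_sub_sq {s : ℝ} (hs : 0 < s) (hs1 : s < 1) :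
    circleAverage (fun w : ℂ => (‖1 - w‖ ^ 2)⁻¹) 0 s = (1 - s ^ 2)⁻¹ := by
  have hne : ∀ w : ℂ, ‖w‖ ≤ s → 1 - w ≠ 0 := by
    rintro w hw h
    rw [← sub_eq_zero.mp h, norm_one] at hw
    linarith
  have hd : DifferentiableOn ℂ (fun w : ℂ => (1 + w) / (1 - w)) (Metric.closedBall 0 s) :=
    fun w hw => (DifferentiableAt.div (by fun_prop) (by fun_prop)
      (hne w (mem_closedBall_zero_iff.mp hw))).differentiableWithinAt
  have hmean : circleAverage (fun w : ℂ => (1 + w) / (1 - w)) 0 s = 1 := by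
    have h := DiffContOnCl.circleAverage (f := fun w : ℂ => (1 + w) / (1 - w)) (c := 0) (R := s)
      (by
        rw [abs_of_pos hs]
        exact hd.diffContOnCl_ball subset_rfl)
    simpa using h
  have hci : CircleIntegrable (fun w : ℂ => (1 + w) / (1 - w)) 0 s :=
    (hd.continuousOn.mono Metric.sphere_subset_closedBall).circleIntegrable hs.le
  have hre := Complex.reCLM.circleAverage_comp_comm hci
  rw [hmean] at hre
  have hkernel : circleAverage (fun w : ℂ => (1 - s ^ 2)⁻¹ • (Complex.reCLM ((1 + w) / (1 - w)))) 0 s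
      = circleAverage (fun w : ℂ => (‖1 - w‖ ^ 2)⁻¹) 0 s := by
    refine circleAverage_congr_sphere fun w hw => ?_
    have hw' : ‖w‖ = s := by simpa [abs_of_pos hs] using hw
    have h1 : 1 - s ^ 2 ≠ 0 := by nlinarith
    have h2 : ‖1 - w‖ ^ 2 ≠ 0 := pow_ne_zero _ (norm_ne_zero_iff.mpr (hne w hw'.le))
    have h3 : ((1 + w) / (1 - w)).re = (1 - s ^ 2) / ‖1 - w‖ ^ 2 := by
      rw [Complex.div_re, ← add_div, Complex.normSq_eq_norm_sq, ← hw', ← Complex.normSq_eq_norm_sq w,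
        Complex.normSq_apply]
      simp
      ring
    simp only [Complex.reCLM_apply, smul_eq_mul, h3]
    field_simp
  rw [← hkernel, circleAverage_fun_smul]
  have hre' : circleAverage (fun w : ℂ => Complex.reCLM ((1 + w) / (1 - w))) 0 s = 1 :=
    hre.trans Complex.one_re
  rw [hre', smul_eq_mul, mul_one]

/-- The Taylor coefficients at `0` of `w ↦ (1 - w a)⁻²` are `(n + 1) aⁿ`. -/
lemma hasFPowerSeriesAt_inverse_one_sub_smul_sq {A : Type*} [NormedRing A] [NormedAlgebra ℂ A]
    [CompleteSpace A] (a : A) :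
    HasFPowerSeriesAt (fun w : ℂ => Ring.inverse (1 - w • a) ^ 2)
      (fun n => ContinuousMultilinearMap.mkPiRing ℂ (Fin n) ((n + 1 : ℂ) • a ^ n)) 0 := by
  refine hasFPowerSeriesAt_iff.mpr ?_
  have hsmall : ∀ᶠ w : ℂ in nhds 0, ‖w • a‖ < 1 := by
    have hc : Continuous fun w : ℂ => ‖w • a‖ := by fun_prop
    exact hc.continuousAt.eventually_lt continuousAt_const (by simp)
  filter_upwards [hsmall] with w hw
  convert! hasSum_choose_mul_geometric_of_norm_lt_one' 1 hw using 1
  · ext n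
    have hcoeff : FormalMultilinearSeries.coeff (fun n => ContinuousMultilinearMap.mkPiRing ℂ (Fin n)
        ((n + 1 : ℂ) • a ^ n)) n = (n + 1 : ℂ) • a ^ n := by
      simp [FormalMultilinearSeries.coeff]
    rw [hcoeff, smul_comm, ← smul_pow, Algebra.smul_def]
    simp
  · simp

lemma inverse_one_sub_smul_eq_inv_smul_resolvent {A : Type*} [Ring A] [Algebra ℂ A] (a : A)
    {w : ℂ} (hw : w ≠ 0) : Ring.inverse (1 - w • a) = w⁻¹ • resolvent a w⁻¹ := by
  have h := spectrum.units_smul_resolvent_self (r := (Units.mk0 w hw)⁻¹) (a := a)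
  simp [resolvent, Units.smul_def] at h ⊢
  exact h.symm

/-- A Ritt operator `T` on a complex Banach space `X`
(spectrum in the closed unit disc and `‖(z-T)⁻¹‖ ≤ C/|z-1|` for `|z| > 1`)
is power bounded. -/
theorem stmt_6 {X : Type*} [NormedAddCommGroup X] [NormedSpace ℂ X] [CompleteSpace X]
    (T : X →L[ℂ] X)
    (hspec : spectrum ℂ T ⊆ Metric.closedBall 0 1)
    (C : ℝ) (hC : 0 < C)
    (hres : ∀ z : ℂ, 1 < ‖z‖ → ‖resolvent T z‖ ≤ C / ‖z - 1‖) :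
    ∃ C₀ : ℝ, ∀ k : ℕ, ‖T ^ k‖ ≤ C₀ := by
  set f : ℂ → (X →L[ℂ] X) := fun w => Ring.inverse (1 - w • T) ^ 2
  have hbound : ∀ w : ℂ, w ≠ 0 → ‖w‖ < 1 → ‖f w‖ ≤ C ^ 2 * (‖1 - w‖ ^ 2)⁻¹ := by
    intro w hw0 hw1
    have hinv : 1 < ‖w⁻¹‖ := by
      rw [norm_inv]
      exact (one_lt_inv₀ (norm_pos_iff.mpr hw0)).mpr hw1
    have hle : ‖Ring.inverse (1 - w • T)‖ ≤ C * ‖1 - w‖⁻¹ := by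
      rw [inverse_one_sub_smul_eq_inv_smul_resolvent T hw0, norm_smul]
      refine (mul_le_mul_of_nonneg_left (hres _ hinv) (norm_nonneg _)).trans_eq ?_
      have : w⁻¹ - 1 = w⁻¹ * (1 - w) := by field_simp
      rw [this, norm_mul]
      have : ‖w⁻¹‖ ≠ 0 := by positivity
      rw [div_mul_eq_div_div, ← mul_div_assoc, mul_div_cancel₀ _ this, div_eq_mul_inv]
    calc ‖f w‖ ≤ ‖Ring.inverse (1 - w • T)‖ ^ 2 := norm_pow_le' _ two_pos
      _ ≤ (C * ‖1 - w‖⁻¹) ^ 2 := by gcongr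
      _ = C ^ 2 * (‖1 - w‖ ^ 2)⁻¹ := by rw [mul_pow, inv_pow]
  have hdiff : ∀ w : ℂ, ‖w‖ < 1 → DifferentiableAt ℂ f w := by
    intro w hw
    have hu : IsUnit (1 - w • T) := by
      refine spectrum.isUnit_one_sub_smul_of_lt_inv_radius ?_
      have hr : spectralRadius ℂ T ≤ 1 := iSup₂_le fun z hz => by
        exact_mod_cast (mem_closedBall_zero_iff.mp (hspec hz))
      exact lt_of_lt_of_le (by exact_mod_cast hw) (ENNReal.one_le_inv.mpr hr)
    have hd : DifferentiableAt ℂ (fun w : ℂ => 1 - w • T) w := by fun_prop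
    exact (DifferentiableAt.comp w (differentiableAt_inverse hu) hd).pow 2
  have hcoeff : ∀ (k : ℕ) (s : ℝ), 0 < s → s < 1 →
      (k + 1) * ‖T ^ k‖ ≤ C ^ 2 * (1 - s ^ 2)⁻¹ * s⁻¹ ^ k := by
    intro k s hs hs1
    lift s to NNReal using hs.le
    have hdiffOn : DifferentiableOn ℂ f (Metric.closedBall 0 s) := fun w hw =>
      (hdiff w ((mem_closedBall_zero_iff.mp hw).trans_lt hs1)).differentiableWithinAt
    have heq := (hasFPowerSeriesAt_inverse_one_sub_smul_sq T).eq_formalMultilinearSeries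
      (hdiffOn.hasFPowerSeriesOnBall (by exact_mod_cast hs)).hasFPowerSeriesAt
    have hnorm := norm_cauchyPowerSeries_le f 0 s k
    rw [← heq, ContinuousMultilinearMap.norm_mkPiRing, norm_smul, abs_of_pos hs] at hnorm
    have hk : ‖(k + 1 : ℂ)‖ = k + 1 := by exact_mod_cast Complex.norm_natCast (k + 1)
    rw [hk] at hnorm
    refine hnorm.trans (mul_le_mul_of_nonneg_right ?_ (by positivity))
    have hci : CircleIntegrable (fun w => ‖f w‖) 0 s :=
      (hdiffOn.continuousOn.norm.mono Metric.sphere_subset_closedBall).circleIntegrable hs.le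
    have hci' : CircleIntegrable (fun w : ℂ => C ^ 2 • (‖1 - w‖ ^ 2)⁻¹) 0 s := by
      refine ContinuousOn.circleIntegrable hs.le fun w hw => ?_
      have hw' : ‖w‖ = s := by simpa using hw
      have : ‖1 - w‖ ^ 2 ≠ 0 := by
        refine pow_ne_zero _ (norm_ne_zero_iff.mpr fun h => ?_)
        rw [← sub_eq_zero.mp h, norm_one] at hw'
        linarith
      have hc : ContinuousAt (fun w : ℂ => ‖1 - w‖ ^ 2) w := by fun_prop
      exact ((hc.inv₀ this).const_smul (C ^ 2)).continuousWithinAt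
    have hmono := Real.circleAverage_mono hci hci' fun w hw => by
      have hw' : ‖w‖ = s := by simpa using hw
      exact hbound w (norm_pos_iff.mp (hw' ▸ hs)) (hw' ▸ hs1)
    rw [Real.circleAverage_fun_smul, circleAverage_inv_norm_one_sub_sq hs hs1] at hmono
    exact hmono
  refine ⟨C ^ 2 * (2 * Real.exp 1), fun k => ?_⟩
  have hk1 : (0 : ℝ) < k + 1 := by positivity
  have hk2 : (0 : ℝ) < k + 2 := by positivity
  set s : ℝ := (k + 1) / (k + 2) with hs
  have hs0 : 0 < s := by positivity
  have hs1 : s < 1 := by rw [hs, div_lt_one hk2]; linarith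
  have hpow : s⁻¹ ^ k ≤ Real.exp 1 := by
    have h1 : s⁻¹ ≤ Real.exp (1 / (k + 1)) := by
      refine le_trans (le_of_eq ?_) (Real.add_one_le_exp _)
      rw [hs]
      field_simp
      ring
    calc s⁻¹ ^ k ≤ Real.exp (1 / (k + 1)) ^ k := by gcongr
      _ = Real.exp (k * (1 / (k + 1))) := (Real.exp_nat_mul _ _).symm
      _ ≤ Real.exp 1 := by
        gcongr
        rw [mul_one_div, div_le_one hk1]
        linarith
  have hgap : (1 - s ^ 2)⁻¹ ≤ 2 * (k + 1 : ℝ) := by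
    have h1 : 1 / (k + 2 : ℝ) ≤ 1 - s ^ 2 := by
      have : 1 / (k + 2 : ℝ) = 1 - s := by rw [hs]; field_simp; ring
      rw [this]
      nlinarith
    calc (1 - s ^ 2)⁻¹ ≤ (1 / (k + 2 : ℝ))⁻¹ := by gcongr
      _ = k + 2 := by rw [one_div, inv_inv]
      _ ≤ 2 * (k + 1) := by linarith [(Nat.cast_nonneg k : (0 : ℝ) ≤ k)]
  have key := hcoeff k s hs0 hs1
  have : (k + 1) * ‖T ^ k‖ ≤ (k + 1) * (C ^ 2 * (2 * Real.exp 1)) := by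
    calc (k + 1) * ‖T ^ k‖ ≤ C ^ 2 * (1 - s ^ 2)⁻¹ * s⁻¹ ^ k := key
      _ ≤ C ^ 2 * (2 * (k + 1)) * Real.exp 1 := by gcongr
      _ = (k + 1) * (C ^ 2 * (2 * Real.exp 1)) := by ring
  exact le_of_mul_le_mul_left this hk1
end

section
/- Let X be a complex Banach space and T ∈ B(X) a Ritt operator (σ(T) ⊆ closed unit disc and ‖(z - T)⁻¹‖ ≤ C/|z-1| for |z| > 1). Then there is a constant C₁ such that n‖T^n - T^{n-1}‖ ≤ C₁ for all n ≥ 1. -/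
open Metric

/-- The mean of `|1 - z|⁻²` over the circle `|z| = ρ < 1` is `(1 - ρ²)⁻¹`. -/
theorem circleAverage_inv_norm_one_sub_sq_s7 {ρ : ℝ} (hρ : 0 < ρ) (hρ' : ρ < 1) :
    Real.circleAverage (fun z : ℂ => (‖1 - z‖ ^ 2)⁻¹) 0 ρ = (1 - ρ ^ 2)⁻¹ := by
  have hmem : (((ρ ^ 2 : ℝ)) : ℂ) ∈ ball (0 : ℂ) ρ := by
    rw [mem_ball_zero_iff, Complex.norm_real, Real.norm_of_nonneg (by positivity)]
    nlinarith
  have hpoisson : Real.circleAverage (poissonKernel 0 ((ρ ^ 2 : ℝ) : ℂ)) 0 ρ = 1 := by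
    have h := DiffContOnCl.circleAverage_poissonKernel_smul (f := fun _ => (1 : ℂ))
      (diffContOnCl_const (s := ball (0 : ℂ) ρ)) hmem
    simp only [Real.circleAverage_def, Pi.smul_apply', Complex.real_smul, mul_one,
      intervalIntegral.integral_ofReal] at h ⊢
    exact_mod_cast h
  have hpos : 0 < 1 - ρ ^ 2 := by nlinarith
  trans (1 - ρ ^ 2)⁻¹ • Real.circleAverage (poissonKernel 0 ((ρ ^ 2 : ℝ) : ℂ)) 0 ρ
  swap
  · rw [hpoisson, smul_eq_mul, mul_one]
  rw [← Real.circleAverage_fun_smul]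
  refine Real.circleAverage_congr_sphere fun z hz => ?_
  have hz' : ‖z‖ = ρ := by simpa [abs_of_pos hρ] using hz
  have hreflect : ‖z - ((ρ ^ 2 : ℝ) : ℂ)‖ = ρ * ‖1 - z‖ := by
    have : z - ((ρ ^ 2 : ℝ) : ℂ) = z * (starRingEnd ℂ) (1 - z) := by
      rw [map_sub, map_one, mul_sub, mul_one, Complex.mul_conj, Complex.normSq_eq_norm_sq, hz']
    rw [this, norm_mul, RCLike.norm_conj, hz']
  have hne : ‖1 - z‖ ≠ 0 := by
    rw [norm_ne_zero_iff, sub_ne_zero]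
    rintro rfl
    rw [norm_one] at hz'
    linarith
  simp only [poissonKernel_def, sub_zero, smul_eq_mul, hreflect, hz', Complex.norm_real,
    Real.norm_of_nonneg (sq_nonneg ρ)]
  have := hpos.ne'
  field_simp

section BanachAlgebra

variable {A : Type*} [NormedRing A] [NormedAlgebra ℂ A]

theorem isUnit_one_sub_smul_of_spectrum_subset {a : A}
    (hspec : spectrum ℂ a ⊆ closedBall 0 1) {w : ℂ} (hw : ‖w‖ < 1) : IsUnit (1 - w • a) := by
  apply spectrum.isUnit_one_sub_smul_of_lt_inv_radius
  have hradius : spectralRadius ℂ a ≤ 1 := by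
    refine iSup₂_le fun z hz => ?_
    have := mem_closedBall_zero_iff.1 (hspec hz)
    exact_mod_cast this
  refine lt_of_lt_of_le ?_ (ENNReal.one_le_inv.2 hradius)
  exact_mod_cast hw

/-- The power series of `w ↦ (1 - w a)⁻³ b` at the origin. -/
theorem hasFPowerSeriesAt_inverse_one_sub_smul_cube_mul [CompleteSpace A] (a b : A) :
    HasFPowerSeriesAt (fun w : ℂ => Ring.inverse (1 - w • a) ^ 3 * b)
      (fun n => ContinuousMultilinearMap.mkPiRing ℂ (Fin n)
        (((n + 2).choose 2 : A) * a ^ n * b)) 0 := by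
  refine hasFPowerSeriesAt_iff.2 ?_
  have hsmall : ∀ᶠ w : ℂ in nhds 0, ‖w • a‖ < 1 := by
    have : Filter.Tendsto (fun w : ℂ => ‖w • a‖) (nhds 0) (nhds 0) :=
      Continuous.tendsto' (by fun_prop) _ _ (by simp)
    exact this.eventually_lt_const one_pos
  filter_upwards [hsmall] with w hw
  rw [zero_add]
  refine ((hasSum_choose_mul_geometric_of_norm_lt_one' 2 hw).mul_right b).congr_fun ?_
  intro n
  simp [FormalMultilinearSeries.coeff, smul_pow, mul_assoc]

theorem norm_inverse_one_sub_smul_cube_mul_sub_one_le {a : A}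
    (hspec : spectrum ℂ a ⊆ closedBall 0 1) {C : ℝ}
    (hres : ∀ z : ℂ, 1 < ‖z‖ → ‖resolvent a z‖ ≤ C / ‖z - 1‖) {w : ℂ} (hw₀ : w ≠ 0)
    (hw : ‖w‖ < 1) :
    ‖Ring.inverse (1 - w • a) ^ 3 * (a - 1)‖ ≤
      C ^ 2 * (C + ‖(1 : A)‖) / ‖w‖ * (‖1 - w‖ ^ 2)⁻¹ := by
  have hw_pos : 0 < ‖w‖ := norm_pos_iff.2 hw₀
  have hz : 1 < ‖w⁻¹‖ := by rw [norm_inv]; exact (one_lt_inv₀ hw_pos).2 hw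
  have hsub_pos : 0 < ‖1 - w‖ := by
    rw [norm_pos_iff, sub_ne_zero]
    rintro rfl
    simp at hw
  set R := resolvent a w⁻¹ with hR
  have hinv : Ring.inverse (1 - w • a) = w⁻¹ • R := by
    have h := spectrum.units_smul_resolvent_self (r := Units.mk0 w⁻¹ (inv_ne_zero hw₀)) (a := a)
    simp only [Units.smul_def, Units.val_mk0, Units.val_inv_eq_inv_val, inv_inv] at h
    rw [hR, h, resolvent, map_one]
  have hmem : IsUnit (algebraMap ℂ A w⁻¹ - a) := by
    by_contra hnot
    have := mem_closedBall_zero_iff.1 (hspec (spectrum.mem_iff.2 hnot))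
    linarith
  have hRa : R * (a - 1) = (w⁻¹ - 1) • R - 1 := by
    have h : R * (algebraMap ℂ A w⁻¹ - a) = 1 := Ring.inverse_mul_cancel _ hmem
    rw [mul_sub, ← Algebra.commutes, ← Algebra.smul_def] at h
    rw [sub_smul, one_smul, mul_sub, mul_one, ← h]
    abel
  have hz_sub : ‖w⁻¹ - 1‖ = ‖1 - w‖ / ‖w‖ := by
    rw [← norm_div]
    congr 1
    field_simp
  have hR_le : ‖R‖ ≤ C * ‖w‖ / ‖1 - w‖ := by
    have h := hres _ hz
    rwa [hz_sub, div_div_eq_mul_div] at h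
  have hRa_le : ‖R * (a - 1)‖ ≤ C + ‖(1 : A)‖ := by
    rw [hRa]
    refine (norm_sub_le _ _).trans (add_le_add ?_ le_rfl)
    rw [norm_smul, hz_sub]
    calc ‖1 - w‖ / ‖w‖ * ‖R‖ ≤ ‖1 - w‖ / ‖w‖ * (C * ‖w‖ / ‖1 - w‖) := by gcongr
      _ = C := by field_simp
  calc ‖Ring.inverse (1 - w • a) ^ 3 * (a - 1)‖
      = (‖w‖⁻¹) ^ 3 * ‖R ^ 2 * (R * (a - 1))‖ := by
        rw [hinv, smul_pow, smul_mul_assoc, norm_smul, norm_pow, norm_inv, pow_succ R 2, mul_assoc]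
    _ ≤ (‖w‖⁻¹) ^ 3 * ((C * ‖w‖ / ‖1 - w‖) ^ 2 * (C + ‖(1 : A)‖)) := by
        gcongr
        refine (norm_mul_le _ _).trans (mul_le_mul ?_ hRa_le (norm_nonneg _) (sq_nonneg _))
        exact (norm_pow_le' R two_pos).trans (by gcongr)
    _ = C ^ 2 * (C + ‖(1 : A)‖) / ‖w‖ * (‖1 - w‖ ^ 2)⁻¹ := by field_simp

/-- The Cauchy estimate on the circle of radius `ρ` for the power series of
`w ↦ (1 - w a)⁻³ (a - 1)`. -/
theorem norm_choose_mul_pow_mul_sub_one_le [CompleteSpace A] {a : A}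
    (hspec : spectrum ℂ a ⊆ closedBall 0 1) {C : ℝ}
    (hres : ∀ z : ℂ, 1 < ‖z‖ → ‖resolvent a z‖ ≤ C / ‖z - 1‖) {ρ : ℝ} (hρ : 0 < ρ) (hρ' : ρ < 1)
    (n : ℕ) :
    ‖((n + 2).choose 2 : A) * a ^ n * (a - 1)‖ ≤
      C ^ 2 * (C + ‖(1 : A)‖) / ρ * (1 - ρ ^ 2)⁻¹ * ρ⁻¹ ^ n := by
  set f : ℂ → A := fun w => Ring.inverse (1 - w • a) ^ 3 * (a - 1)
  have hdiff : DifferentiableOn ℂ f (closedBall 0 ρ) := by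
    intro w hw
    have hu : IsUnit (1 - w • a) := isUnit_one_sub_smul_of_spectrum_subset hspec
      ((mem_closedBall_zero_iff.1 hw).trans_lt hρ')
    have hlin : DifferentiableAt ℂ (fun w : ℂ => 1 - w • a) w := by fun_prop
    exact (((DifferentiableAt.comp w (differentiableAt_inverse hu) hlin).pow 3).mul_const
      (a - 1)).differentiableWithinAt
  lift ρ to NNReal using hρ.le
  have hseries :=
    (hasFPowerSeriesAt_inverse_one_sub_smul_cube_mul a (a - 1)).eq_formalMultilinearSeries
      (hdiff.hasFPowerSeriesOnBall (by exact_mod_cast hρ)).hasFPowerSeriesAt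
  have hcauchy := norm_cauchyPowerSeries_le f 0 ρ n
  rw [← hseries, ContinuousMultilinearMap.norm_mkPiRing, abs_of_pos hρ] at hcauchy
  refine hcauchy.trans ?_
  refine mul_le_mul_of_nonneg_right ?_ (by positivity)
  have hsphere : sphere (0 : ℂ) |(ρ : ℝ)| ⊆ closedBall 0 ρ := by
    rw [abs_of_pos hρ]; exact sphere_subset_closedBall
  have hne : ∀ z ∈ sphere (0 : ℂ) |(ρ : ℝ)|, ‖1 - z‖ ^ 2 ≠ 0 := by
    intro z hz
    rw [pow_ne_zero_iff two_ne_zero, norm_ne_zero_iff, sub_ne_zero]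
    rintro rfl
    have := mem_closedBall_zero_iff.1 (hsphere hz)
    rw [norm_one] at this
    linarith
  rw [← circleAverage_inv_norm_one_sub_sq_s7 hρ hρ', ← smul_eq_mul (_ / _),
    ← Real.circleAverage_fun_smul]
  refine Real.circleAverage_mono (f₁ := fun z => ‖f z‖) ?_ ?_ fun z hz => ?_
  · exact ContinuousOn.circleIntegrable' (hdiff.continuousOn.norm.mono hsphere)
  · have hinv : ContinuousOn (fun z : ℂ => (‖1 - z‖ ^ 2)⁻¹) (sphere 0 |(ρ : ℝ)|) :=
      ContinuousOn.inv₀ (by fun_prop) hne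
    exact ContinuousOn.circleIntegrable' (hinv.const_smul (C ^ 2 * (C + ‖(1 : A)‖) / (ρ : ℝ)))
  · have hz' : ‖z‖ = ρ := by simpa using hz
    have h := norm_inverse_one_sub_smul_cube_mul_sub_one_le hspec hres
      (w := z) (by rw [← norm_pos_iff, hz']; exact hρ) (hz'.trans_lt hρ')
    rwa [hz'] at h

theorem add_one_mul_norm_pow_mul_sub_one_le [CompleteSpace A] {a : A}
    (hspec : spectrum ℂ a ⊆ closedBall 0 1) {C : ℝ} (hC : 0 ≤ C)
    (hres : ∀ z : ℂ, 1 < ‖z‖ → ‖resolvent a z‖ ≤ C / ‖z - 1‖) (n : ℕ) :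
    (n + 1 : ℝ) * ‖a ^ n * (a - 1)‖ ≤ 2 * Real.exp 1 * (C ^ 2 * (C + ‖(1 : A)‖)) := by
  set K : ℝ := C ^ 2 * (C + ‖(1 : A)‖)
  have hK₀ : 0 ≤ K := by positivity
  set ρ : ℝ := (n + 1) / (n + 2) with hρ
  have hρ₀ : 0 < ρ := by positivity
  have hρ₁ : ρ < 1 := by rw [hρ, div_lt_one (by positivity)]; linarith
  have hpow : ρ⁻¹ ^ (n + 1) ≤ Real.exp 1 := by
    have h := Real.one_add_inv_pow_le_exp (n := n + 1)
    convert h using 2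
    rw [hρ]
    push_cast
    field_simp
    ring
  have hinv : (1 - ρ ^ 2)⁻¹ ≤ (n + 2 : ℝ) := by
    have h : (1 - ρ)⁻¹ = n + 2 := by rw [hρ]; field_simp; ring
    rw [← h]
    exact inv_anti₀ (by linarith) (by nlinarith)
  have hchoose : ((n + 2).choose 2 : ℝ) = (n + 2) * (n + 1) / 2 := by
    rw [Nat.cast_choose_two]; push_cast; ring
  have hmain := norm_choose_mul_pow_mul_sub_one_le hspec hres hρ₀ hρ₁ n
  have hnorm : ‖((n + 2).choose 2 : A) * a ^ n * (a - 1)‖ =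
      (n + 2) * (n + 1) / 2 * ‖a ^ n * (a - 1)‖ := by
    rw [mul_assoc, ← nsmul_eq_mul, ← Nat.cast_smul_eq_nsmul ℂ, norm_smul, Complex.norm_natCast,
      hchoose]
  rw [hnorm] at hmain
  have hbound : (n + 2 : ℝ) * (n + 1) / 2 * ‖a ^ n * (a - 1)‖ ≤ K * (n + 2) * Real.exp 1 := by
    refine hmain.trans ?_
    calc K / ρ * (1 - ρ ^ 2)⁻¹ * ρ⁻¹ ^ n = K * (1 - ρ ^ 2)⁻¹ * ρ⁻¹ ^ (n + 1) := by
          rw [pow_succ]; ring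
      _ ≤ K * (n + 2) * Real.exp 1 := by gcongr
  refine le_of_mul_le_mul_left ?_ (show (0 : ℝ) < (n + 2) / 2 by positivity)
  linarith

end BanachAlgebra

/-- A Ritt operator `T` (spectrum in the closed unit disc and
`‖(z-T)⁻¹‖ ≤ C/|z-1|` for `|z| > 1`) satisfies `n‖Tⁿ - Tⁿ⁻¹‖ ≤ C₁`. -/
theorem stmt_7 {X : Type*} [NormedAddCommGroup X] [NormedSpace ℂ X] [CompleteSpace X]
    (T : X →L[ℂ] X)
    (hspec : spectrum ℂ T ⊆ Metric.closedBall 0 1)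
    (C : ℝ) (hC : 0 < C)
    (hres : ∀ z : ℂ, 1 < ‖z‖ → ‖resolvent T z‖ ≤ C / ‖z - 1‖) :
    ∃ C₁ : ℝ, ∀ n : ℕ, 1 ≤ n → (n : ℝ) * ‖T ^ n - T ^ (n - 1)‖ ≤ C₁ := by
  refine ⟨2 * Real.exp 1 * (C ^ 2 * (C + ‖(1 : X →L[ℂ] X)‖)), fun n hn => ?_⟩
  obtain ⟨m, rfl⟩ := Nat.exists_eq_add_of_le' hn
  have h := add_one_mul_norm_pow_mul_sub_one_le hspec hC.le hres m
  rw [mul_sub, mul_one, ← pow_succ] at h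
  rw [Nat.add_sub_cancel]
  exact_mod_cast h
end
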